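/- arXiv:1109.3247 — 2 statements merged into one kernel-verified Lean document; each statement's English description precedes it below -/
import Mathlib

section
/- Flatness lemma for parabolic convex functions: There exists ε₀ > 0 depending only on n with the following property. Let Δt > 0, r ∈ (0,3), M ∈ ℝ, and let Γ : B₃×[−Δt,0] → ℝ be parabolic convex, i.e. Γ(·,t) is convex on B₃ for each t and Γ(x,·) is nonincreasing for each x. If |{(x,t) ∈ (B_r∖B_{r/2})×[−Δt,−Δt/2] : Γ(x,t) ≥ M}| ≤ ε₀·|(B_r∖B_{r/2})×[−Δt,−Δt/2]|, then Γ ≤ M on B_{r/2}×[−Δt/2,0]. -/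
open MeasureTheory Set Filter
open scoped RealInnerProductSpace ENNReal

noncomputable section

/-- Euclidean space ℝⁿ. -/
abbrev E (n : ℕ) := EuclideanSpace ℝ (Fin n)

namespace NLP

variable {n : ℕ}

/-- Second order difference in space: δ(u,x,t;y) = u(x+y,t)+u(x−y,t)−2u(x,t). -/
def sdelta (u : E n → ℝ → ℝ) (x : E n) (t : ℝ) (y : E n) : ℝ :=
  u (x + y) t + u (x - y) t - 2 * u x t

/-- Positive part δ⁺. -/
def sdeltaP (u : E n → ℝ → ℝ) (x : E n) (t : ℝ) (y : E n) : ℝ := max (sdelta u x t y) 0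

/-- Negative part δ⁻. -/
def sdeltaN (u : E n → ℝ → ℝ) (x : E n) (t : ℝ) (y : E n) : ℝ := max (-sdelta u x t y) 0

/-- Minimal Pucci extremal operator M⁻_{L₀(Λ,σ)}. -/
def Mminus (Λ σ : ℝ) (u : E n → ℝ → ℝ) (x : E n) (t : ℝ) : ℝ :=
  (2 - σ) * ∫ y : E n,
    (Λ⁻¹ * sdeltaP u x t y - Λ * sdeltaN u x t y) / ‖y‖ ^ ((n : ℝ) + σ)

/-- Maximal Pucci extremal operator M⁺_{L₀(Λ,σ)}. -/
def Mplus (Λ σ : ℝ) (u : E n → ℝ → ℝ) (x : E n) (t : ℝ) : ℝ :=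
  (2 - σ) * ∫ y : E n,
    (Λ * sdeltaP u x t y - Λ⁻¹ * sdeltaN u x t y) / ‖y‖ ^ ((n : ℝ) + σ)

/-- The weight ω(y) = (1+|y|^{n+σ})⁻¹. -/
def wt (σ : ℝ) (y : E n) : ℝ := (1 + ‖y‖ ^ ((n : ℝ) + σ))⁻¹

/-- v ∈ L¹(ω). -/
def MemL1w (σ : ℝ) (v : E n → ℝ) : Prop := Integrable fun y => v y * wt σ y

/-- v ∈ C(a,b;L¹(ω)). -/
def InCL1w (σ a b : ℝ) (v : E n → ℝ → ℝ) : Prop :=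
  (∀ t ∈ Ioc a b, MemL1w σ fun y => v y t) ∧
    ∀ t₂ ∈ Ioc a b,
      Tendsto (fun t₁ => ∫ y : E n, |v y t₁ - v y t₂| * wt σ y)
        (nhdsWithin t₂ (Iio t₂)) (nhds 0)

/-- The parabolic cylinder B_r(x) × (t−τ, t]. -/
def pcyl (x : E n) (r t τ : ℝ) : Set (E n × ℝ) := Metric.ball x r ×ˢ Ioc (t - τ) t

/-- v coincides on S with a quadratic parabolic polynomial whose time slope is c. -/
def IsParQuadOn (v : E n → ℝ → ℝ) (S : Set (E n × ℝ)) (c : ℝ) : Prop :=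
  ∃ (A : E n →L[ℝ] E n →L[ℝ] ℝ) (b : E n →L[ℝ] ℝ) (d : ℝ),
    ∀ p ∈ S, v p.1 p.2 = A p.1 p.1 + b p.1 + c * p.2 + d

/-- Viscosity supersolution u_t − Iu ≥ f in D, tested with parabolic quadratic
polynomials extended in C(t−τ,t;L¹(ω)) touching u from below at the top–center
of their cylinder.  (The left time derivative of such a test function is its
time slope c.) -/
def IsSupersol (σ : ℝ) (I : (E n → ℝ → ℝ) → E n → ℝ → ℝ) (u : E n → ℝ → ℝ)
    (D : Set (E n × ℝ)) (f : E n → ℝ → ℝ) : Prop :=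
  ∀ (v : E n → ℝ → ℝ) (x : E n) (t r τ c : ℝ), 0 < r → 0 < τ →
    pcyl x r t τ ⊆ D →
    InCL1w σ (t - τ) t v →
    IsParQuadOn v (pcyl x r t τ) c →
    v x t = u x t →
    (∀ p ∈ pcyl x r t τ, p ≠ (x, t) → v p.1 p.2 < u p.1 p.2) →
    f x t ≤ c - I v x t

/-- Viscosity subsolution u_t − Iu ≤ f in D. -/
def IsSubsol (σ : ℝ) (I : (E n → ℝ → ℝ) → E n → ℝ → ℝ) (u : E n → ℝ → ℝ)
    (D : Set (E n × ℝ)) (f : E n → ℝ → ℝ) : Prop :=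
  ∀ (v : E n → ℝ → ℝ) (x : E n) (t r τ c : ℝ), 0 < r → 0 < τ →
    pcyl x r t τ ⊆ D →
    InCL1w σ (t - τ) t v →
    IsParQuadOn v (pcyl x r t τ) c →
    v x t = u x t →
    (∀ p ∈ pcyl x r t τ, p ≠ (x, t) → u p.1 p.2 < v p.1 p.2) →
    c - I v x t ≤ f x t

/-- Lower semicontinuity on S with respect to the parabolic topology. -/
def ParLSCOn (u : E n → ℝ → ℝ) (S : Set (E n × ℝ)) : Prop :=
  ∀ p ∈ S, ∀ ε > (0 : ℝ), ∃ δ > (0 : ℝ), ∀ q ∈ S,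
    dist q.1 p.1 < δ → q.2 ∈ Ioc (p.2 - δ) p.2 → u p.1 p.2 - ε < u q.1 q.2

/-- Upper semicontinuity on S with respect to the parabolic topology. -/
def ParUSCOn (u : E n → ℝ → ℝ) (S : Set (E n × ℝ)) : Prop :=
  ∀ p ∈ S, ∀ ε > (0 : ℝ), ∃ δ > (0 : ℝ), ∀ q ∈ S,
    dist q.1 p.1 < δ → q.2 ∈ Ioc (p.2 - δ) p.2 → u q.1 q.2 < u p.1 p.2 + ε

/-- Continuity on S with respect to the parabolic topology. -/
def ParContinuousOn (F : E n × ℝ → ℝ) (S : Set (E n × ℝ)) : Prop :=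
  ∀ p ∈ S, ∀ ε > (0 : ℝ), ∃ δ > (0 : ℝ), ∀ q ∈ S,
    dist q.1 p.1 < δ → q.2 ∈ Ioc (p.2 - δ) p.2 → |F q - F p| < ε

/-- u(·,t) is C^{1,1} in space at the point x (punctual C^{1,1}). -/
def C11At (u : E n → ℝ → ℝ) (x : E n) (t : ℝ) : Prop :=
  ∃ (v : E n) (M r : ℝ), 0 < r ∧
    ∀ y : E n, ‖y‖ < r → |u (x + y) t - u x t - ⟪v, y⟫| ≤ M * ‖y‖ ^ 2

/-- I is elliptic with respect to the class L₀(Λ,σ). -/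
def IsElliptic (Λ σ : ℝ) (I : (E n → ℝ → ℝ) → E n → ℝ → ℝ) : Prop :=
  ∀ (u v : E n → ℝ → ℝ) (x : E n) (t : ℝ),
    MemL1w σ (fun y => u y t) → MemL1w σ (fun y => v y t) →
    C11At u x t → C11At v x t →
    Mminus Λ σ (fun y s => u y s - v y s) x t ≤ I u x t - I v x t ∧
      I u x t - I v x t ≤ Mplus Λ σ (fun y s => u y s - v y s) x t

/-- I is continuous: Iv is parabolically continuous on the cylinder of every
test function v. -/
def IsContinuousOp (σ : ℝ) (I : (E n → ℝ → ℝ) → E n → ℝ → ℝ) : Prop :=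
  ∀ (v : E n → ℝ → ℝ) (x : E n) (t r τ c : ℝ), 0 < r → 0 < τ →
    InCL1w σ (t - τ) t v → IsParQuadOn v (pcyl x r t τ) c →
    ParContinuousOn (fun p => I v p.1 p.2) (pcyl x r t τ)

/-- Left time derivative v_{t⁻}. -/
def leftTimeDeriv (v : E n → ℝ → ℝ) (x : E n) (t : ℝ) : ℝ :=
  derivWithin (fun s => v x s) (Iic t) t

/-- The monotone decreasing envelope in time ū(x,t) = inf_{s∈[a,t]} u(x,s). -/
def ubar (u : E n → ℝ → ℝ) (a : ℝ) (x : E n) (t : ℝ) : ℝ :=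
  sInf ((fun s => u x s) '' Icc a t)

/-- Parabolic convex envelope of u: supremum of affine functions of x which are
below ū(·,t) on Ω₀ and below 0 on Ω. -/
def pconvEnv (u : E n → ℝ → ℝ) (a : ℝ) (Ω₀ Ω : Set (E n)) (x : E n) (t : ℝ) : ℝ :=
  sSup {v : ℝ | ∃ (p : E n) (c : ℝ), v = ⟪p, x⟫ + c ∧
    (∀ z ∈ Ω₀, ⟪p, z⟫ + c ≤ ubar u a z t) ∧ ∀ z ∈ Ω, ⟪p, z⟫ + c ≤ 0}

/-- Sub-differential of g at x (relative to the domain D). -/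
def subdiff (g : E n → ℝ) (D : Set (E n)) (x : E n) : Set (E n) :=
  {p | ∀ z ∈ D, g x + ⟪p, z - x⟫ ≤ g z}

/-- Legendre transform centered at x₀:
h(p,t) = sup{h : p·(x−x₀)+h ≤ G(x,t) for all x ∈ D}. -/
def legendreh (G : E n → ℝ → ℝ) (x₀ : E n) (D : Set (E n)) (p : E n) (t : ℝ) : ℝ :=
  sSup {h : ℝ | ∀ x ∈ D, ⟪p, x - x₀⟫ + h ≤ G x t}

/-- Φ(K) = {(p, h(p,t)) : (x,t) ∈ K, p ∈ ∂G(x,t)}. -/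
def PhiSet (G : E n → ℝ → ℝ) (x₀ : E n) (D : Set (E n)) (K : Set (E n × ℝ)) :
    Set (E n × ℝ) :=
  {q | ∃ xt ∈ K, q.1 ∈ subdiff (fun z => G z xt.2) D xt.1 ∧
    q.2 = legendreh G x₀ D q.1 xt.2}

/-- Open cube centered at c with side s. -/
def cube (c : E n) (s : ℝ) : Set (E n) := {x | ∀ i, |x i - c i| < s / 2}

/-- Essential supremum-type norm: sup of f over S. -/
def supOn (f : ℝ → ℝ) (S : Set ℝ) : ℝ := sSup (f '' S)

/-- Negative part u⁻ = max(−u,0). -/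
def negPart (r : ℝ) : ℝ := max (-r) 0

end NLP

/-- A point outside an open convex set is separated from it by a unit vector. -/
theorem Convex.exists_norm_eq_one_inner_le {F : Type*} [NormedAddCommGroup F]
    [InnerProductSpace ℝ F] [CompleteSpace F] [Nontrivial F] {C : Set F} (hC : Convex ℝ C)
    (hopen : IsOpen C) {x₀ : F} (hx₀ : x₀ ∉ C) :
    ∃ p : F, ‖p‖ = 1 ∧ ∀ x ∈ C, ⟪p, x⟫ ≤ ⟪p, x₀⟫ := by
  rcases C.eq_empty_or_nonempty with rfl | ⟨y, hy⟩
  · obtain ⟨p, hp⟩ := exists_norm_eq F (zero_le_one' ℝ)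
    exact ⟨p, hp, by simp⟩
  · obtain ⟨f, hf⟩ := geometric_hahn_banach_open_point hC hopen hx₀
    set q := (InnerProductSpace.toDual ℝ F).symm f
    have hq : ∀ x, ⟪q, x⟫ = f x := fun x => InnerProductSpace.toDual_symm_apply
    have hq0 : q ≠ 0 := by
      intro h
      have := hf y hy
      rw [← hq, ← hq, h] at this
      simp at this
    refine ⟨‖q‖⁻¹ • q, norm_smul_inv_norm (𝕜 := ℝ) hq0, fun x hx => ?_⟩
    rw [real_inner_smul_left, real_inner_smul_left, hq, hq]
    exact mul_le_mul_of_nonneg_left (hf x hx).le (by positivity)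

/-- If a convex function on `B_R` exceeds `M` somewhere in `B_{r/2}`, then it is at least `M` on
some ball of radius `r / 4` contained in the ring `B_r \ B_{r/2}`. -/
theorem ConvexOn.exists_ball_subset_superlevel_ring {F : Type*} [NormedAddCommGroup F]
    [InnerProductSpace ℝ F] [FiniteDimensional ℝ F] [Nontrivial F] {R r M : ℝ} {g : F → ℝ}
    (hr : 0 < r) (hrR : r ≤ R) (hg : ConvexOn ℝ (Metric.ball (0 : F) R) g) {x₀ : F}
    (hx₀ : x₀ ∈ Metric.ball (0 : F) (r / 2)) (hM : M ≤ g x₀) :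
    ∃ c : F, ∀ x ∈ Metric.ball c (r / 4),
      x ∈ Metric.ball (0 : F) r \ Metric.ball (0 : F) (r / 2) ∧ M ≤ g x := by
  have hopen : IsOpen {x ∈ Metric.ball (0 : F) R | g x < M} :=
    (hg.continuousOn Metric.isOpen_ball).isOpen_inter_preimage Metric.isOpen_ball isOpen_Iio
  obtain ⟨p, hp, hsep⟩ := (hg.convex_lt M).exists_norm_eq_one_inner_le hopen
    (x₀ := x₀) (fun h => h.2.not_ge hM)
  have hpp : ⟪p, p⟫ = 1 := by rw [real_inner_self_eq_norm_sq, hp, one_pow]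
  rw [mem_ball_zero_iff] at hx₀
  have hpx₀ : ⟪p, x₀⟫ < r / 2 := by
    have := real_inner_le_norm p x₀
    rw [hp, one_mul] at this
    exact this.trans_lt hx₀
  refine ⟨(3 / 4 * r) • p, fun x hx => ?_⟩
  rw [mem_ball_iff_norm] at hx
  have hxp : r / 2 < ⟪p, x⟫ := by
    have h := (abs_le.1 (abs_real_inner_le_norm p (x - (3 / 4 * r) • p))).1
    rw [hp, one_mul, inner_sub_right, real_inner_smul_right, hpp] at h
    linarith
  have hxr : ‖x‖ < r := by
    have h := norm_le_norm_add_norm_sub ((3 / 4 * r) • p) x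
    rw [norm_sub_rev, norm_smul, hp, Real.norm_of_nonneg (by positivity)] at h
    linarith
  have hrx : r / 2 ≤ ‖x‖ := by
    have := real_inner_le_norm p x
    rw [hp, one_mul] at this
    linarith
  refine ⟨by simpa using ⟨hxr, hrx⟩, ?_⟩
  by_contra! h
  have := hsep x ⟨mem_ball_zero_iff.2 (hxr.trans_le hrR), h⟩
  linarith

open NLP in
/-- **Flatness lemma for parabolic convex functions** (Lemma 3.9). -/
theorem parabolic_convex_flatness (n : ℕ) (hn : 1 ≤ n) :
    ∃ ε₀ : ℝ, 0 < ε₀ ∧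
      ∀ (Δt r M : ℝ) (G : E n → ℝ → ℝ),
        0 < Δt → r ∈ Ioo (0 : ℝ) 3 →
        -- G is parabolic convex on B₃ × [−Δt,0]
        (∀ t ∈ Icc (-Δt) 0, ConvexOn ℝ (Metric.ball (0 : E n) 3) fun x => G x t) →
        (∀ x ∈ Metric.ball (0 : E n) 3, AntitoneOn (fun t => G x t) (Icc (-Δt) 0)) →
        -- smallness of the superlevel set in the ring
        (volume {p : E n × ℝ |
            p ∈ (Metric.ball (0 : E n) r \ Metric.ball (0 : E n) (r / 2)) ×ˢ
              Icc (-Δt) (-Δt / 2) ∧ M ≤ G p.1 p.2}).toReal ≤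
          ε₀ * (volume ((Metric.ball (0 : E n) r \ Metric.ball (0 : E n) (r / 2)) ×ˢ
            Icc (-Δt) (-Δt / 2))).toReal →
        -- conclusion: G ≤ M on B_{r/2} × [−Δt/2, 0]
        ∀ x ∈ Metric.ball (0 : E n) (r / 2), ∀ t ∈ Icc (-Δt / 2) (0 : ℝ),
          G x t ≤ M := by
  have : NeZero n := ⟨by omega⟩
  refine ⟨(1 / 4) ^ n / 2, by positivity, ?_⟩
  rintro Δt r M G hΔ ⟨hr, hr3⟩ hconv hanti hmeas x hx t ht
  by_contra! hM
  have hhalf : -Δt / 2 ∈ Icc (-Δt) 0 := ⟨by linarith, by linarith⟩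
  have hx3 : x ∈ Metric.ball (0 : E n) 3 := Metric.ball_subset_ball (by linarith) hx
  have hMx : M ≤ G x (-Δt / 2) :=
    hM.le.trans (hanti x hx3 hhalf ⟨hhalf.1.trans ht.1, ht.2⟩ ht.1)
  obtain ⟨c, hc⟩ :=
    (hconv _ hhalf).exists_ball_subset_superlevel_ring hr hr3.le hx hMx
  set I := Icc (-Δt) (-Δt / 2)
  have hI : volume.real I = Δt / 2 := by
    rw [Real.volume_real_Icc_of_le hhalf.1]; ring
  have hlower : Metric.ball c (r / 4) ×ˢ I ⊆
      {p : E n × ℝ | p ∈ (Metric.ball (0 : E n) r \ Metric.ball (0 : E n) (r / 2)) ×ˢ I ∧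
        M ≤ G p.1 p.2} := by
    rintro ⟨y, s⟩ ⟨hy, hs⟩
    obtain ⟨hring, hMy⟩ := hc y hy
    exact ⟨⟨hring, hs⟩, hMy.trans (hanti y (Metric.ball_subset_ball hr3.le hring.1)
      ⟨hs.1, hs.2.trans hhalf.2⟩ hhalf hs.2)⟩
  have hupper : (Metric.ball (0 : E n) r \ Metric.ball (0 : E n) (r / 2)) ×ˢ I ⊆
      Metric.ball (0 : E n) r ×ˢ I := prod_mono_left sdiff_subset
  have hfin : volume (Metric.ball (0 : E n) r ×ˢ I) ≠ ⊤ := by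
    rw [Measure.volume_eq_prod, Measure.prod_prod]
    exact ENNReal.mul_ne_top measure_ball_lt_top.ne measure_Icc_lt_top.ne
  have hvol : ∀ (z : E n) (ρ : ℝ), 0 < ρ → volume.real (Metric.ball z ρ ×ˢ I) =
      ρ ^ n * volume.real (Metric.ball (0 : E n) 1) * (Δt / 2) := by
    intro z ρ hρ
    rw [Measure.volume_eq_prod, measureReal_prod_prod, hI,
      ← Measure.addHaar_real_closedBall_eq_addHaar_real_ball,
      Measure.addHaar_real_closedBall _ _ hρ.le, finrank_euclideanSpace_fin]
  have hl := measureReal_mono hlower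
    (measure_ne_top_of_subset (fun _ hp => hupper hp.1) hfin)
  have hu := measureReal_mono hupper hfin
  rw [hvol _ _ (by positivity)] at hl
  rw [hvol _ _ hr] at hu
  have hω : 0 < volume.real (Metric.ball (0 : E n) 1) :=
    ENNReal.toReal_pos (Metric.measure_ball_pos _ _ one_pos).ne' measure_ball_lt_top.ne
  have hpos : 0 < (1 / 4) ^ n * (r ^ n * volume.real (Metric.ball (0 : E n) 1) * (Δt / 2)) := by
    positivity
  have hscale : (r / 4) ^ n = (1 / 4) ^ n * r ^ n := by rw [← mul_pow]; ring
  rw [hscale] at hl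
  have hsmall := hl.trans (hmeas.trans (mul_le_mul_of_nonneg_left hu (by positivity)))
  linarith
end
end

section
/- Special function: Let σ₀ ∈ (0,2) and Λ ≥ 1. There exist a function p ∈ C(ℝⁿ×[0,80]) and a constant C > 1, depending only on n, Λ and σ₀, such that p(·,t) is C^{1,1} in the space variable, p is C¹ in the time variable with respect to the parabolic topology (the left time derivative p_{t⁻} exists and is continuous), and for every σ ∈ (σ₀,2): (1) p_{t⁻}(x,t) − M⁻_{L₀(Λ,σ)}p(x,t) ≤ −1 + C·χ_{B_{1/4}×(0,1]}(x,t) for all (x,t) ∈ B_{4√n}×(0,80], with M⁻_{L₀(Λ,σ)}p evaluated classically; (2) p ≤ 0 on ((ℝⁿ∖B_{2√n})×(0,80]) ∪ (ℝⁿ×{0}); (3) p > 2 on Q₃×[1,80]. -/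
open MeasureTheory Set Filter
open scoped RealInnerProductSpace ENNReal

noncomputable section

namespace NLP

theorem setIntegral_ball_eq_integral_norm {n : ℕ} (f : ℝ → ℝ) (r : ℝ) :
    ∫ y in Metric.ball (0 : E n) r, f ‖y‖ = ∫ y : E n, (Iio r).indicator f ‖y‖ := by
  rw [← integral_indicator measurableSet_ball]
  refine integral_congr_ae (Eventually.of_forall fun y => ?_)
  by_cases hy : ‖y‖ < r <;> simp [indicator, hy]

theorem norm_rpow_kernel_near {n : ℕ} (hn : 1 ≤ n) {σ r : ℝ} (hσ : σ < 2) (hr : 0 < r) :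
    IntegrableOn (fun y : E n => ‖y‖ ^ 2 / ‖y‖ ^ ((n : ℝ) + σ)) (Metric.ball 0 r) ∧
    ∫ y in Metric.ball (0 : E n) r, ‖y‖ ^ 2 / ‖y‖ ^ ((n : ℝ) + σ) =
      n * volume.real (Metric.ball (0 : E n) 1) * (r ^ (2 - σ) / (2 - σ)) := by
  have : Nonempty (Fin n) := ⟨⟨0, hn⟩⟩
  have key : ∀ s : ℝ, 0 < s → s ^ (n - 1) * (s ^ 2 / s ^ ((n : ℝ) + σ)) = s ^ (1 - σ) := by
    intro s hs
    rw [← Real.rpow_natCast s (n - 1), ← Real.rpow_natCast s 2, ← Real.rpow_sub hs,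
      ← Real.rpow_add hs, Nat.cast_sub hn]
    congr 1
    push_cast
    ring
  constructor
  · rw [integrableOn_fun_norm_addHaar (E := E n) volume
      (f := fun s : ℝ => s ^ 2 / s ^ ((n : ℝ) + σ))]
    simp only [finrank_euclideanSpace_fin, smul_eq_mul]
    refine IntegrableOn.congr_fun ?_ (fun s hs => (key s hs.1).symm) measurableSet_Ioo
    rw [intervalIntegral.integrableOn_Ioo_rpow_iff hr]
    linarith
  · rw [setIntegral_ball_eq_integral_norm (fun s : ℝ => s ^ 2 / s ^ ((n : ℝ) + σ)),
      integral_fun_norm_addHaar]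
    simp only [finrank_euclideanSpace_fin, smul_eq_mul, nsmul_eq_mul]
    have : ∫ s in Ioi (0 : ℝ), s ^ (n - 1) *
        (Iio r).indicator (fun s : ℝ => s ^ 2 / s ^ ((n : ℝ) + σ)) s = r ^ (2 - σ) / (2 - σ) := by
      have h1 : ∫ s in Ioi (0 : ℝ), s ^ (n - 1) *
          (Iio r).indicator (fun s : ℝ => s ^ 2 / s ^ ((n : ℝ) + σ)) s =
          ∫ s in Ioi (0 : ℝ), (Iio r).indicator (fun s : ℝ => s ^ (1 - σ)) s := by
        refine setIntegral_congr_fun measurableSet_Ioi fun s hs => ?_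
        by_cases hsr : s < r
        · simpa [indicator, hsr] using key s hs
        · simp [indicator, hsr]
      rw [h1, setIntegral_indicator measurableSet_Iio, Ioi_inter_Iio,
        ← integral_Ioc_eq_integral_Ioo, ← intervalIntegral.integral_of_le hr.le,
        integral_rpow (Or.inl (by linarith)), Real.zero_rpow (by linarith)]
      ring_nf
    rw [this]
    ring

theorem norm_rpow_kernel_far {n : ℕ} (hn : 1 ≤ n) {σ r : ℝ} (hσ : 0 < σ) (hr : 0 < r) :
    IntegrableOn (fun y : E n => 1 / ‖y‖ ^ ((n : ℝ) + σ)) (Metric.ball 0 r)ᶜ ∧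
    ∫ y in (Metric.ball (0 : E n) r)ᶜ, 1 / ‖y‖ ^ ((n : ℝ) + σ) =
      n * volume.real (Metric.ball (0 : E n) 1) * (r ^ (-σ) / σ) := by
  have : Nonempty (Fin n) := ⟨⟨0, hn⟩⟩
  have key : ∀ s : ℝ, 0 < s → s ^ (n - 1) * (1 / s ^ ((n : ℝ) + σ)) = s ^ (-σ - 1) := by
    intro s hs
    rw [← Real.rpow_natCast s (n - 1), one_div, ← Real.rpow_neg hs.le,
      ← Real.rpow_add hs, Nat.cast_sub hn]
    congr 1
    push_cast
    ring
  have hind : (Metric.ball (0 : E n) r)ᶜ.indicator (fun y : E n => 1 / ‖y‖ ^ ((n : ℝ) + σ)) =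
      fun y : E n => (Ici r).indicator (fun s : ℝ => 1 / s ^ ((n : ℝ) + σ)) ‖y‖ := by
    funext y
    by_cases hy : ‖y‖ < r <;> simp [indicator, hy, not_lt.1]
  have key2 : ∀ s ∈ Ioi (0 : ℝ), s ^ (n - 1) *
      (Ici r).indicator (fun s : ℝ => 1 / s ^ ((n : ℝ) + σ)) s =
      (Ici r).indicator (fun s : ℝ => s ^ (-σ - 1)) s := by
    intro s hs
    by_cases hsr : r ≤ s
    · simpa [indicator, hsr] using key s hs
    · simp [indicator, hsr]
  have hsub : Ioi (0 : ℝ) ∩ Ici r = Ici r := inter_eq_right.2 fun s hs => hr.trans_le hs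
  constructor
  · rw [← integrable_indicator_iff measurableSet_ball.compl, hind, integrable_fun_norm_addHaar]
    simp only [finrank_euclideanSpace_fin, smul_eq_mul]
    refine IntegrableOn.congr_fun ?_ (fun s hs => (key2 s hs).symm) measurableSet_Ioi
    rw [integrableOn_indicator_iff measurableSet_Ici, inter_comm, hsub, integrableOn_Ici_iff_integrableOn_Ioi]
    exact integrableOn_Ioi_rpow_of_lt (by linarith) hr
  · rw [← integral_indicator measurableSet_ball.compl, hind, integral_fun_norm_addHaar]
    simp only [finrank_euclideanSpace_fin, smul_eq_mul, nsmul_eq_mul]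
    rw [setIntegral_congr_fun measurableSet_Ioi key2, setIntegral_indicator measurableSet_Ici,
      hsub, integral_Ici_eq_integral_Ioi, integral_Ioi_rpow_of_lt (by linarith) hr]
    have : (-σ - 1 + 1) = -σ := by ring
    rw [this]
    field_simp

theorem exists_linearIsometryEquiv_apply_eq {n : ℕ} {x z : E n} (h : ‖x‖ = ‖z‖) :
    ∃ R : E n ≃ₗᵢ[ℝ] E n, R x = z :=
  ⟨_, Submodule.reflection_sub h⟩

theorem inner_sq_kernel_near {n : ℕ} (hn : 1 ≤ n) {σ r : ℝ} (hσ : σ < 2) (hr : 0 < r) (x : E n) :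
    IntegrableOn (fun y : E n => ⟪x, y⟫ ^ 2 / ‖y‖ ^ ((n : ℝ) + σ)) (Metric.ball 0 r) ∧
    ∫ y in Metric.ball (0 : E n) r, ⟪x, y⟫ ^ 2 / ‖y‖ ^ ((n : ℝ) + σ) =
      ‖x‖ ^ 2 * volume.real (Metric.ball (0 : E n) 1) * (r ^ (2 - σ) / (2 - σ)) := by
  obtain ⟨hint, hval⟩ := norm_rpow_kernel_near hn hσ hr
  have hI : ∀ x : E n,
      IntegrableOn (fun y : E n => ⟪x, y⟫ ^ 2 / ‖y‖ ^ ((n : ℝ) + σ)) (Metric.ball 0 r) := by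
    intro x
    refine Integrable.mono' (hint.const_mul (‖x‖ ^ 2)) ?_ (Eventually.of_forall fun y => ?_)
    · exact Measurable.aestronglyMeasurable (by fun_prop)
    · rw [Real.norm_of_nonneg (by positivity), ← mul_div_assoc, ← mul_pow]
      gcongr ?_ / _
      exact sq_le_sq' (by linarith [neg_le_of_abs_le (abs_real_inner_le_norm x y)])
        (real_inner_le_norm x y)
  have hrot : ∀ x z : E n, ‖x‖ = ‖z‖ →
      ∫ y in Metric.ball (0 : E n) r, ⟪x, y⟫ ^ 2 / ‖y‖ ^ ((n : ℝ) + σ) =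
      ∫ y in Metric.ball (0 : E n) r, ⟪z, y⟫ ^ 2 / ‖y‖ ^ ((n : ℝ) + σ) := by
    intro x z h
    obtain ⟨R, rfl⟩ := exists_linearIsometryEquiv_apply_eq h
    have hpre : R ⁻¹' Metric.ball (0 : E n) r = Metric.ball 0 r := by
      ext y; simp
    have := (LinearIsometryEquiv.measurePreserving R).setIntegral_preimage_emb
      R.toHomeomorph.measurableEmbedding
      (fun y => ⟪R x, y⟫ ^ 2 / ‖y‖ ^ ((n : ℝ) + σ)) (Metric.ball 0 r)
    rw [← this, hpre]
    simp
  refine ⟨hI x, ?_⟩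
  have hn0 : (n : ℝ) ≠ 0 := by positivity
  have hsum : ∑ i : Fin n, ∫ y in Metric.ball (0 : E n) r,
      ⟪EuclideanSpace.single i ‖x‖, y⟫ ^ 2 / ‖y‖ ^ ((n : ℝ) + σ) =
      ‖x‖ ^ 2 * (n * volume.real (Metric.ball (0 : E n) 1) * (r ^ (2 - σ) / (2 - σ))) := by
    rw [← integral_finsetSum _ fun i _ => hI _, ← hval, ← integral_const_mul]
    refine integral_congr_ae (Eventually.of_forall fun y => ?_)
    simp only [EuclideanSpace.inner_single_left, ← Finset.sum_div, mul_pow, ← Finset.mul_sum]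
    rw [EuclideanSpace.norm_sq_eq y]
    simp [mul_div_assoc]
  rw [Finset.sum_congr rfl fun i _ => (hrot x (EuclideanSpace.single i ‖x‖) (by simp)).symm] at hsum
  rw [Finset.sum_const, Finset.card_univ, Fintype.card_fin, nsmul_eq_mul] at hsum
  apply mul_left_cancel₀ hn0
  rw [hsum]
  ring

/-- The scalar Pucci function `d ↦ Λ⁻¹ d⁺ - Λ d⁻`. -/
def pucci (Λ d : ℝ) : ℝ := Λ⁻¹ * max d 0 - Λ * max (-d) 0

theorem abs_pucci_le {Λ : ℝ} (hΛ : 1 ≤ Λ) (d : ℝ) : |pucci Λ d| ≤ Λ * |d| := by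
  have h1 : Λ⁻¹ ≤ Λ := (inv_le_one_of_one_le₀ hΛ).trans hΛ
  have h0 : 0 < Λ⁻¹ := by positivity
  unfold pucci
  rcases le_total 0 d with hd | hd
  · rw [max_eq_left hd, max_eq_right (by linarith), mul_zero, sub_zero, abs_mul, abs_of_pos h0]
    gcongr
  · rw [max_eq_right hd, max_eq_left (by linarith), mul_zero, zero_sub, abs_neg, abs_mul, abs_neg,
      abs_of_pos (by linarith : 0 < Λ)]

theorem sub_le_pucci {Λ a b d : ℝ} (hΛ : 1 ≤ Λ) (ha : 0 ≤ a) (hb : 0 ≤ b) (h : b - a ≤ d) :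
    Λ⁻¹ * b - Λ * a ≤ pucci Λ d := by
  have h1 : Λ⁻¹ ≤ Λ := (inv_le_one_of_one_le₀ hΛ).trans hΛ
  have h0 : 0 < Λ⁻¹ := by positivity
  unfold pucci
  rcases le_total 0 d with hd | hd
  · rw [max_eq_left hd, max_eq_right (by linarith)]
    nlinarith
  · rw [max_eq_right hd, max_eq_left (by linarith)]
    nlinarith

theorem continuous_pucci (Λ : ℝ) : Continuous (pucci Λ) := by
  unfold pucci
  fun_prop

theorem measurable_pucci_kernel {n : ℕ} (Λ σ : ℝ) {d : E n → ℝ} (hd : Continuous d) :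
    Measurable fun y : E n => pucci Λ (d y) / ‖y‖ ^ ((n : ℝ) + σ) :=
  ((continuous_pucci Λ).comp hd).measurable.div (by fun_prop)

theorem integrable_pucci_kernel {n : ℕ} (hn : 1 ≤ n) {Λ σ L M : ℝ} (hΛ : 1 ≤ Λ) (hσ : 0 < σ)
    (hσ2 : σ < 2) {d : E n → ℝ} (hd : Continuous d) (hL : ∀ y, |d y| ≤ L * ‖y‖ ^ 2)
    (hM : ∀ y, |d y| ≤ M) :
    Integrable fun y : E n => pucci Λ (d y) / ‖y‖ ^ ((n : ℝ) + σ) := by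
  have hm := measurable_pucci_kernel Λ σ hd
  rw [← integrableOn_univ, ← union_compl_self (Metric.ball (0 : E n) 1)]
  refine IntegrableOn.union ?_ ?_
  · refine Integrable.mono' ((norm_rpow_kernel_near hn hσ2 one_pos).1.const_mul (Λ * L))
      hm.aestronglyMeasurable (Eventually.of_forall fun y => ?_)
    rw [norm_div, Real.norm_eq_abs, Real.norm_of_nonneg (by positivity : 0 ≤ ‖y‖ ^ ((n : ℝ) + σ)),
      ← mul_div_assoc]
    gcongr
    calc |pucci Λ (d y)| ≤ Λ * |d y| := abs_pucci_le hΛ _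
      _ ≤ Λ * (L * ‖y‖ ^ 2) := by gcongr; exact hL y
      _ = _ := by ring
  · refine Integrable.mono' ((norm_rpow_kernel_far hn hσ one_pos).1.const_mul (Λ * M))
      hm.aestronglyMeasurable (Eventually.of_forall fun y => ?_)
    rw [norm_div, Real.norm_eq_abs, Real.norm_of_nonneg (by positivity : 0 ≤ ‖y‖ ^ ((n : ℝ) + σ)),
      mul_one_div]
    gcongr
    exact (abs_pucci_le hΛ _).trans (by gcongr; exact hM y)

theorem neg_le_integral_pucci_kernel {n : ℕ} (hn : 1 ≤ n) {Λ σ₀ σ L M : ℝ} (hΛ : 1 ≤ Λ)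
    (hσ₀ : 0 < σ₀) (hσ : σ₀ < σ) (hσ2 : σ < 2) {d : E n → ℝ} (hd : Continuous d)
    (hL : ∀ y, |d y| ≤ L * ‖y‖ ^ 2) (hM : ∀ y, |d y| ≤ M) :
    -(Λ * (n * volume.real (Metric.ball (0 : E n) 1)) * (L + M * (2 / σ₀))) ≤
      (2 - σ) * ∫ y : E n, pucci Λ (d y) / ‖y‖ ^ ((n : ℝ) + σ) := by
  have hσp : 0 < σ := hσ₀.trans hσ
  have hint := integrable_pucci_kernel hn hΛ hσp hσ2 hd hL hM
  obtain ⟨i1, v1⟩ := norm_rpow_kernel_near hn hσ2 one_pos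
  obtain ⟨i2, v2⟩ := norm_rpow_kernel_far hn hσp one_pos
  set ω := volume.real (Metric.ball (0 : E n) 1)
  have hω : 0 ≤ ω := measureReal_nonneg
  have hM0 : 0 ≤ M := (abs_nonneg _).trans (hM 0)
  have h1 : ∫ y in Metric.ball (0 : E n) 1, -(Λ * L) * (‖y‖ ^ 2 / ‖y‖ ^ ((n : ℝ) + σ)) ≤
      ∫ y in Metric.ball (0 : E n) 1, pucci Λ (d y) / ‖y‖ ^ ((n : ℝ) + σ) := by
    refine setIntegral_mono_on (i1.const_mul _) hint.integrableOn measurableSet_ball fun y _ => ?_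
    rw [← mul_div_assoc]
    gcongr
    have := neg_le_of_abs_le (abs_pucci_le hΛ (d y))
    have h3 : Λ * |d y| ≤ Λ * (L * ‖y‖ ^ 2) := by gcongr; exact hL y
    linarith
  have h2 : ∫ y in (Metric.ball (0 : E n) 1)ᶜ, -(Λ * M) * (1 / ‖y‖ ^ ((n : ℝ) + σ)) ≤
      ∫ y in (Metric.ball (0 : E n) 1)ᶜ, pucci Λ (d y) / ‖y‖ ^ ((n : ℝ) + σ) := by
    refine setIntegral_mono_on (i2.const_mul _) hint.integrableOn measurableSet_ball.compl
      fun y _ => ?_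
    rw [mul_one_div]
    gcongr
    have := neg_le_of_abs_le (abs_pucci_le hΛ (d y))
    have h3 : Λ * |d y| ≤ Λ * M := by gcongr; exact hM y
    linarith
  rw [integral_const_mul, v1, Real.one_rpow] at h1
  rw [integral_const_mul, v2, Real.one_rpow] at h2
  rw [← integral_add_compl (measurableSet_ball (x := (0 : E n)) (ε := 1)) hint]
  have h2σ : 0 < 2 - σ := by linarith
  have h3 := mul_le_mul_of_nonneg_left (add_le_add h1 h2) h2σ.le
  refine le_trans ?_ h3
  have h4 : (2 - σ) * (1 / σ) ≤ 2 / σ₀ := by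
    rw [mul_one_div]
    gcongr
    linarith
  have h5 : Λ * M * (n * ω) * ((2 - σ) * (1 / σ)) ≤ Λ * M * (n * ω) * (2 / σ₀) := by gcongr
  have h6 : (2 - σ) * (1 / (2 - σ)) = 1 := by field_simp
  linear_combination h5 + Λ * L * (n * ω) * h6

theorem le_integral_pucci_kernel_of_quadratic {n : ℕ} (hn : 1 ≤ n) {Λ σ₀ σ L M α k : ℝ}
    (hΛ : 1 ≤ Λ) (hσ₀ : 0 < σ₀) (hσ : σ₀ < σ) (hσ2 : σ < 2) (hα : 1 ≤ α) (hk : 0 ≤ k)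
    {d : E n → ℝ} (hd : Continuous d)
    (hL : ∀ y, |d y| ≤ L * ‖y‖ ^ 2) (hM : ∀ y, |d y| ≤ M) {x : E n} (hx : 1 / 4 ≤ ‖x‖)
    (hnear : ∀ y, α * ‖y‖ ^ 2 ≤ 1 / 4 →
      k * (3 / 2 * α ^ 2 * ⟪x, y⟫ ^ 2 - α * ‖y‖ ^ 2) ≤ d y)
    (hfar : ∀ y, -k ≤ d y)
    (hbig : 3 * n * α / 2 ≤ volume.real (Metric.ball (0 : E n) 1) * (4 * α) ^ (σ₀ / 2) *
      (3 * α / (128 * Λ) - Λ * n / 4 - Λ * n * (2 / σ₀))) :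
    k * (3 * n * α / 2) ≤ (2 - σ) * ∫ y : E n, pucci Λ (d y) / ‖y‖ ^ ((n : ℝ) + σ) := by
  have hσp : 0 < σ := hσ₀.trans hσ
  have hint := integrable_pucci_kernel hn hΛ hσp hσ2 hd hL hM
  set r : ℝ := (4 * α) ^ (-(1 / 2) : ℝ) with hr_def
  have h4α : 0 < 4 * α := by positivity
  have hr : 0 < r := Real.rpow_pos_of_pos h4α _
  have hr2 : r ^ 2 = (4 * α)⁻¹ := by
    rw [hr_def, ← Real.rpow_natCast, ← Real.rpow_mul h4α.le, ← Real.rpow_neg_one]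
    norm_num
  have hrσ : r ^ (-σ) = (4 * α) ^ (σ / 2) := by
    rw [hr_def, ← Real.rpow_mul h4α.le]
    ring_nf
  have hr2σ : r ^ (2 - σ) = (4 * α)⁻¹ * (4 * α) ^ (σ / 2) := by
    rw [sub_eq_add_neg, Real.rpow_add hr, hrσ, ← hr2, Real.rpow_two]
  obtain ⟨i1, v1⟩ := norm_rpow_kernel_near hn hσ2 hr
  obtain ⟨i2, v2⟩ := norm_rpow_kernel_far hn hσp hr
  obtain ⟨i3, v3⟩ := inner_sq_kernel_near hn hσ2 hr x
  set ω := volume.real (Metric.ball (0 : E n) 1)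
  have hω : 0 ≤ ω := measureReal_nonneg
  have h1 : ∫ y in Metric.ball (0 : E n) r,
        ((Λ⁻¹ * k * (3 / 2) * α ^ 2) * (⟪x, y⟫ ^ 2 / ‖y‖ ^ ((n : ℝ) + σ)) -
          (Λ * k * α) * (‖y‖ ^ 2 / ‖y‖ ^ ((n : ℝ) + σ))) ≤
      ∫ y in Metric.ball (0 : E n) r, pucci Λ (d y) / ‖y‖ ^ ((n : ℝ) + σ) := by
    refine setIntegral_mono_on ((i3.const_mul _).sub (i1.const_mul _)) hint.integrableOn
      measurableSet_ball fun y hy => ?_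
    rw [← mul_div_assoc _ (⟪x, y⟫ ^ 2), ← mul_div_assoc _ (‖y‖ ^ 2), ← sub_div]
    gcongr
    have hy' : ‖y‖ < r := by simpa using hy
    have hyα : α * ‖y‖ ^ 2 ≤ 1 / 4 := by
      have : ‖y‖ ^ 2 ≤ (4 * α)⁻¹ := hr2 ▸ by gcongr
      calc α * ‖y‖ ^ 2 ≤ α * (4 * α)⁻¹ := by gcongr
        _ = 1 / 4 := by field_simp
    have := sub_le_pucci (a := k * (α * ‖y‖ ^ 2)) (b := k * (3 / 2 * α ^ 2 * ⟪x, y⟫ ^ 2)) (d := d y)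
      hΛ (by positivity) (by positivity) (by linarith [hnear y hyα])
    linarith
  have h2 : ∫ y in (Metric.ball (0 : E n) r)ᶜ, -(Λ * k) * (1 / ‖y‖ ^ ((n : ℝ) + σ)) ≤
      ∫ y in (Metric.ball (0 : E n) r)ᶜ, pucci Λ (d y) / ‖y‖ ^ ((n : ℝ) + σ) := by
    refine setIntegral_mono_on (i2.const_mul _) hint.integrableOn measurableSet_ball.compl
      fun y _ => ?_
    rw [mul_one_div]
    gcongr
    have := sub_le_pucci (a := k) (b := 0) (d := d y) hΛ hk le_rfl (by linarith [hfar y])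
    linarith
  rw [integral_sub (i3.const_mul _) (i1.const_mul _), integral_const_mul, integral_const_mul, v1,
    v3, hr2σ] at h1
  rw [integral_const_mul, v2, hrσ] at h2
  rw [← integral_add_compl (measurableSet_ball (x := (0 : E n)) (ε := r)) hint]
  have h2σ : 0 < 2 - σ := by linarith
  have h3 := mul_le_mul_of_nonneg_left (add_le_add h1 h2) h2σ.le
  refine le_trans ?_ h3
  set P := (4 * α) ^ (σ / 2) with hP
  have hPP : (4 * α) ^ (σ₀ / 2) ≤ P := Real.rpow_le_rpow_of_exponent_le (by linarith) (by linarith)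
  have hP₀ : 0 < (4 * α) ^ (σ₀ / 2) := Real.rpow_pos_of_pos h4α _
  have hPpos : 0 < P := hP₀.trans_le hPP
  have heq : (2 - σ) * (Λ⁻¹ * k * (3 / 2) * α ^ 2 *
      (‖x‖ ^ 2 * ω * ((4 * α)⁻¹ * P / (2 - σ))) -
      Λ * k * α * (n * ω * ((4 * α)⁻¹ * P / (2 - σ))) + -(Λ * k) * (n * ω * (P / σ))) =
      k * (ω * P * (3 * α / (8 * Λ) * ‖x‖ ^ 2 - Λ * n / 4 - Λ * n * ((2 - σ) / σ))) := by
    have : 2 - σ ≠ 0 := h2σ.ne'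
    field_simp
    ring
  rw [heq]
  gcongr
  have hx2 : 1 / 16 ≤ ‖x‖ ^ 2 := by nlinarith
  have hb : 3 * α / (128 * Λ) ≤ 3 * α / (8 * Λ) * ‖x‖ ^ 2 := by
    calc 3 * α / (128 * Λ) = 3 * α / (8 * Λ) * (1 / 16) := by field_simp; norm_num
      _ ≤ _ := by gcongr
  have h4 : (2 - σ) / σ ≤ 2 / σ₀ := by
    gcongr
    linarith
  have h5 : Λ * n * ((2 - σ) / σ) ≤ Λ * n * (2 / σ₀) := by gcongr
  have hbr : 0 ≤ 3 * α / (128 * Λ) - Λ * n / 4 - Λ * n * (2 / σ₀) := by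
    by_contra hneg
    have : ω * (4 * α) ^ (σ₀ / 2) * (3 * α / (128 * Λ) - Λ * n / 4 - Λ * n * (2 / σ₀)) ≤ 0 :=
      mul_nonpos_of_nonneg_of_nonpos (by positivity) (not_le.1 hneg).le
    have : 0 < 3 * (n : ℝ) * α / 2 := by positivity
    linarith
  refine hbig.trans ?_
  have hle : 3 * α / (128 * Λ) - Λ * n / 4 - Λ * n * (2 / σ₀) ≤
      3 * α / (8 * Λ) * ‖x‖ ^ 2 - Λ * n / 4 - Λ * n * ((2 - σ) / σ) := by linarith
  exact mul_le_mul (by gcongr) hle hbr (by positivity)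

theorem exists_gaussian_exponent {n : ℕ} (hn : 1 ≤ n) {Λ σ₀ : ℝ} (hΛ : 1 ≤ Λ) (hσ₀ : 0 < σ₀) :
    ∃ α : ℝ, 1 ≤ α ∧
      3 * n * α / 2 ≤ volume.real (Metric.ball (0 : E n) 1) * (4 * α) ^ (σ₀ / 2) *
        (3 * α / (128 * Λ) - Λ * n / 4 - Λ * n * (2 / σ₀)) := by
  set ω := volume.real (Metric.ball (0 : E n) 1) with hω_def
  have hω : 0 < ω := 
    ENNReal.toReal_pos (Metric.measure_ball_pos _ _ one_pos).ne' measure_ball_lt_top.ne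
  set D := Λ * n / 4 + Λ * n * (2 / σ₀) with hD_def
  have hT : Tendsto (fun α : ℝ => (4 * α) ^ (σ₀ / 2)) atTop atTop :=
    (tendsto_rpow_atTop (by positivity)).comp (tendsto_id.const_mul_atTop (by norm_num))
  obtain ⟨α, h1, hD, hP⟩ := ((eventually_ge_atTop (1 : ℝ)).and
    ((eventually_ge_atTop (64 * Λ * D)).and
      (hT.eventually_ge_atTop (3 * n / 2 * (128 * Λ) / ω)))).exists
  refine ⟨α, h1, ?_⟩
  have hbr : α / (128 * Λ) ≤ 3 * α / (128 * Λ) - Λ * n / 4 - Λ * n * (2 / σ₀) := by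
    have : D ≤ 2 * α / (128 * Λ) := by
      rw [le_div_iff₀ (by positivity)]
      linarith
    have h3 : 3 * α / (128 * Λ) = α / (128 * Λ) + 2 * α / (128 * Λ) := by ring
    rw [h3]
    linarith
  rw [div_le_iff₀ hω] at hP
  calc 3 * n * α / 2 = 3 * n / 2 * (128 * Λ) * (α / (128 * Λ)) := by field_simp
    _ ≤ ω * (4 * α) ^ (σ₀ / 2) * (α / (128 * Λ)) := by rw [mul_comm ω]; gcongr
    _ ≤ _ := by gcongr

/-- The Gaussian `exp (-α |x|²)`. -/
def gauss {n : ℕ} (α : ℝ) (x : E n) : ℝ := Real.exp (-(α * ‖x‖ ^ 2))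

/-- The truncated Gaussian `((c exp (-α |x|²) - 1)⁺)²`. -/
def truncGauss {n : ℕ} (α c : ℝ) (x : E n) : ℝ := max (c * gauss α x - 1) 0 ^ 2

theorem one_add_sq_div_two_le_cosh (u : ℝ) : 1 + u ^ 2 / 2 ≤ Real.cosh u := by
  have h : ∀ v : ℝ, v ^ 2 ≤ Real.sinh v ^ 2 := by
    intro v
    rw [sq_le_sq, Real.abs_sinh]
    exact Real.self_le_sinh_iff.2 (abs_nonneg v)
  have h1 : Real.cosh u = 1 + 2 * Real.sinh (u / 2) ^ 2 := by
    have := Real.cosh_two_mul (u / 2)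
    rw [Real.cosh_sq, mul_div_cancel₀ _ two_ne_zero] at this
    linarith
  rw [h1]
  linarith [h (u / 2)]

theorem hasDerivAt_max_zero_sq (s : ℝ) :
    HasDerivAt (fun s : ℝ => max s 0 ^ 2) (2 * max s 0) s := by
  rcases lt_trichotomy s 0 with h | rfl | h
  · rw [max_eq_right h.le, mul_zero]
    refine (hasDerivAt_const s (0 : ℝ)).congr_of_eventuallyEq ?_
    filter_upwards [Iio_mem_nhds h] with u hu
    simp [max_eq_right (le_of_lt (mem_Iio.1 hu))]
  · rw [max_self, mul_zero, hasDerivAt_iff_isLittleO]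
    simp only [sub_zero, max_self, smul_zero, ne_eq, OfNat.ofNat_ne_zero, not_false_eq_true,
      zero_pow]
    have h1 : (fun u : ℝ => max u 0 ^ 2) =O[nhds 0] fun u : ℝ => u ^ 2 := by
      refine Asymptotics.IsBigO.of_bound 1 (Eventually.of_forall fun u => ?_)
      rw [one_mul, Real.norm_of_nonneg (sq_nonneg _), Real.norm_of_nonneg (sq_nonneg _), sq_le_sq,
        abs_of_nonneg (le_max_right u 0)]
      exact max_le (le_abs_self u) (abs_nonneg u)
    exact h1.trans_isLittleO (Asymptotics.isLittleO_pow_id one_lt_two)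
  · rw [max_eq_left h.le]
    have h2 : HasDerivAt (fun s : ℝ => s ^ 2) (2 * s) s := by
      simpa using hasDerivAt_pow 2 s
    refine h2.congr_of_eventuallyEq ?_
    filter_upwards [Ioi_mem_nhds h] with u hu
    simp [max_eq_left (le_of_lt (mem_Ioi.1 hu))]

theorem max_zero_sq_convex (a b : ℝ) :
    max b 0 ^ 2 + 2 * max b 0 * (a - b) ≤ max a 0 ^ 2 := by
  have h1 : a ≤ max a 0 := le_max_left _ _
  have h2 : 0 ≤ max b 0 := le_max_right _ _
  have h3 : max b 0 * b = max b 0 ^ 2 := by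
    rcases le_total 0 b with h | h
    · rw [max_eq_left h]; ring
    · rw [max_eq_right h]; ring
  nlinarith [sq_nonneg (max a 0 - max b 0), mul_le_mul_of_nonneg_left h1 h2]

variable {n : ℕ}

theorem continuous_gauss (α : ℝ) : Continuous (gauss α : E n → ℝ) := by
  unfold gauss
  fun_prop

theorem gauss_pos (α : ℝ) (x : E n) : 0 < gauss α x := Real.exp_pos _

theorem gauss_le_one {α : ℝ} (hα : 0 ≤ α) (x : E n) : gauss α x ≤ 1 :=
  Real.exp_le_one_iff.2 (by nlinarith [mul_nonneg hα (sq_nonneg ‖x‖)])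

theorem gauss_second_difference (α : ℝ) (x y : E n) :
    gauss α (x + y) + gauss α (x - y) - 2 * gauss α x =
      2 * gauss α x * (Real.exp (-(α * ‖y‖ ^ 2)) * Real.cosh (2 * α * ⟪x, y⟫) - 1) := by
  unfold gauss
  rw [norm_add_sq_real, norm_sub_sq_real, Real.cosh_eq]
  have h1 : -(α * (‖x‖ ^ 2 + 2 * ⟪x, y⟫ + ‖y‖ ^ 2)) =
    -(α * ‖x‖ ^ 2) + (-(α * ‖y‖ ^ 2) + -(2 * α * ⟪x, y⟫)) := by ring
  have h2 : -(α * (‖x‖ ^ 2 - 2 * ⟪x, y⟫ + ‖y‖ ^ 2)) =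
    -(α * ‖x‖ ^ 2) + (-(α * ‖y‖ ^ 2) + (2 * α * ⟪x, y⟫)) := by ring
  rw [h1, h2, Real.exp_add, Real.exp_add, Real.exp_add, Real.exp_add]
  ring

theorem truncGauss_nonneg (α c : ℝ) (x : E n) : 0 ≤ truncGauss α c x := sq_nonneg _

theorem continuous_truncGauss (α c : ℝ) : Continuous (truncGauss α c : E n → ℝ) := by
  have := continuous_gauss (n := n) α
  unfold truncGauss
  fun_prop

theorem trunc_le {α c : ℝ} (hα : 0 ≤ α) (hc : 0 ≤ c) (x : E n) : max (c * gauss α x - 1) 0 ≤ c :=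
  max_le (by nlinarith [gauss_le_one hα x]) hc

theorem truncGauss_le {α c : ℝ} (hα : 0 ≤ α) (hc : 0 ≤ c) (x : E n) : truncGauss α c x ≤ c ^ 2 :=
  pow_le_pow_left₀ (le_max_right _ _) (trunc_le hα hc x) 2

/-- The scalar factor by which convexity transfers lower bounds from the Gaussian to
its truncation. -/
def truncSlope (α c : ℝ) (x : E n) : ℝ :=
  2 * max (c * gauss α x - 1) 0 * c * (2 * gauss α x)

theorem truncSlope_nonneg {α c : ℝ} (hc : 0 ≤ c) (x : E n) : 0 ≤ truncSlope α c x := by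
  have := gauss_pos α x
  unfold truncSlope
  positivity

theorem truncGauss_second_difference_ge (α c : ℝ) (x y : E n) :
    truncSlope α c x * (Real.exp (-(α * ‖y‖ ^ 2)) * Real.cosh (2 * α * ⟪x, y⟫) - 1) ≤
      truncGauss α c (x + y) + truncGauss α c (x - y) - 2 * truncGauss α c x := by
  have h := gauss_second_difference α x y
  have h1 := max_zero_sq_convex (c * gauss α (x + y) - 1) (c * gauss α x - 1)
  have h2 := max_zero_sq_convex (c * gauss α (x - y) - 1) (c * gauss α x - 1)
  unfold truncGauss truncSlope
  linear_combination h1 + h2 - 2 * max (c * gauss α x - 1) 0 * c * h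

theorem gauss_factor_ge (α : ℝ) (x y : E n) :
    -1 ≤ Real.exp (-(α * ‖y‖ ^ 2)) * Real.cosh (2 * α * ⟪x, y⟫) - 1 := by
  have := mul_pos (Real.exp_pos (-(α * ‖y‖ ^ 2))) (Real.cosh_pos (2 * α * ⟪x, y⟫))
  linarith

theorem gauss_factor_ge_quadratic {α : ℝ} {x y : E n} (h : α * ‖y‖ ^ 2 ≤ 1 / 4) :
    3 / 2 * α ^ 2 * ⟪x, y⟫ ^ 2 - α * ‖y‖ ^ 2 ≤
      Real.exp (-(α * ‖y‖ ^ 2)) * Real.cosh (2 * α * ⟪x, y⟫) - 1 := by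
  have h1 : 1 - α * ‖y‖ ^ 2 ≤ Real.exp (-(α * ‖y‖ ^ 2)) := by
    linarith [Real.add_one_le_exp (-(α * ‖y‖ ^ 2))]
  have h2 := one_add_sq_div_two_le_cosh (2 * α * ⟪x, y⟫)
  have h3 := mul_le_mul h1 h2 (by positivity) (Real.exp_pos _).le
  nlinarith [mul_nonneg (sub_nonneg.2 h) (sq_nonneg (α * ⟪x, y⟫))]

theorem hasGradientAt_gauss (α : ℝ) (x : E n) :
    HasGradientAt (gauss α) ((-(2 * α * gauss α x)) • x) x := by
  rw [hasGradientAt_iff_hasFDerivAt]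
  have h := (((hasStrictFDerivAt_norm_sq x).hasFDerivAt.const_mul α).neg).exp
  refine h.congr_fderiv ?_
  ext z
  simp [gauss]
  ring

theorem hasGradientAt_truncGauss (α c : ℝ) (x : E n) :
    HasGradientAt (truncGauss α c)
      ((-(4 * α * c) * max (c * gauss α x - 1) 0) • (gauss α x • x)) x := by
  rw [hasGradientAt_iff_hasFDerivAt]
  have hg := (hasGradientAt_iff_hasFDerivAt.1 (hasGradientAt_gauss α x))
  have h := (hasDerivAt_max_zero_sq (c * gauss α x - 1)).comp_hasFDerivAt x
    ((hg.const_mul c).sub_const 1)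
  refine h.congr_fderiv ?_
  ext z
  simp
  ring

theorem norm_gauss_smul_le {α : ℝ} (hα : 1 ≤ α) (x : E n) : ‖gauss α x • x‖ ≤ 1 := by
  rw [norm_smul, Real.norm_of_nonneg (gauss_pos α x).le]
  unfold gauss
  rw [Real.exp_neg, inv_mul_le_one₀ (Real.exp_pos _)]
  have h1 := Real.add_one_le_exp (α * ‖x‖ ^ 2)
  nlinarith [sq_nonneg (‖x‖ - 1), sq_nonneg ‖x‖]

theorem abs_gauss_sub_le {α : ℝ} (hα : 1 ≤ α) (x z : E n) :
    |gauss α x - gauss α z| ≤ 2 * α * ‖x - z‖ := by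
  have := Convex.norm_image_sub_le_of_norm_hasFDerivWithin_le (𝕜 := ℝ) (f := gauss α)
    (s := univ) (x := z) (y := x) (C := 2 * α)
    (fun w _ => (hasGradientAt_iff_hasFDerivAt.1 (hasGradientAt_gauss α w)).hasFDerivWithinAt)
    (fun w _ => ?_) convex_univ (mem_univ _) (mem_univ _)
  · simpa using this
  · rw [LinearIsometryEquiv.norm_map, show (-(2 * α * gauss α w)) • w = (-(2 * α)) • (gauss α w • w) by
      rw [smul_smul]; ring_nf, norm_smul, norm_neg, Real.norm_of_nonneg (by linarith)]
    nlinarith [norm_gauss_smul_le hα w]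

theorem norm_gauss_smul_sub_le {α : ℝ} (hα : 1 ≤ α) (x z : E n) :
    ‖gauss α x • x - gauss α z • z‖ ≤ 3 * ‖x - z‖ := by
  refine Convex.norm_image_sub_le_of_norm_hasFDerivWithin_le (𝕜 := ℝ) (f := fun w => gauss α w • w)
    (s := univ) (x := z) (y := x) (C := 3)
    (fun w _ => ((hasGradientAt_iff_hasFDerivAt.1 (hasGradientAt_gauss α w)).smul
      (hasFDerivAt_id w)).hasFDerivWithinAt)
    (fun w _ => ?_) convex_univ (mem_univ _) (mem_univ _)
  refine ContinuousLinearMap.opNorm_le_bound _ (by norm_num) fun y => ?_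
  have hg := gauss_pos α w
  have h1 : gauss α w * (1 + 2 * α * ‖w‖ ^ 2) ≤ 3 := by
    have h := Real.add_one_le_exp (α * ‖w‖ ^ 2)
    have h2 : gauss α w * Real.exp (α * ‖w‖ ^ 2) = 1 := by
      unfold gauss
      rw [← Real.exp_add, neg_add_cancel, Real.exp_zero]
    nlinarith [mul_le_mul_of_nonneg_left h hg.le]
  have hα0 : 0 ≤ α := by linarith
  calc _ = ‖gauss α w • y + (-(2 * α * gauss α w) * ⟪w, y⟫) • w‖ := by
        simp
    _ ≤ ‖gauss α w • y‖ + ‖(-(2 * α * gauss α w) * ⟪w, y⟫) • w‖ := norm_add_le _ _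
    _ = gauss α w * ‖y‖ + 2 * α * gauss α w * |⟪w, y⟫| * ‖w‖ := by
        rw [norm_smul, norm_smul, norm_mul, norm_neg, Real.norm_of_nonneg hg.le,
          Real.norm_of_nonneg (by positivity : 0 ≤ 2 * α * gauss α w), Real.norm_eq_abs]
    _ ≤ gauss α w * ‖y‖ + 2 * α * gauss α w * (‖w‖ * ‖y‖) * ‖w‖ := by
        gcongr
        exact abs_real_inner_le_norm w y
    _ = gauss α w * (1 + 2 * α * ‖w‖ ^ 2) * ‖y‖ := by ring
    _ ≤ 3 * ‖y‖ := by gcongr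

theorem norm_gradient_truncGauss_sub_le {α c : ℝ} (hα : 1 ≤ α) (hc : 0 ≤ c) (x z : E n) :
    ‖(-(4 * α * c) * max (c * gauss α x - 1) 0) • (gauss α x • x) -
      (-(4 * α * c) * max (c * gauss α z - 1) 0) • (gauss α z • z)‖ ≤
      4 * α * c ^ 2 * (3 + 2 * α) * ‖x - z‖ := by
  have hα0 : 0 ≤ α := by linarith
  set s := max (c * gauss α x - 1) 0
  set s' := max (c * gauss α z - 1) 0
  set V := gauss α x • x
  set V' := gauss α z • z
  have hs : |s| ≤ c := by
    rw [abs_of_nonneg (le_max_right _ _)]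
    exact trunc_le hα0 hc x
  have hss : |s - s'| ≤ c * (2 * α * ‖x - z‖) := by
    refine (abs_max_sub_max_le_abs _ _ _).trans ?_
    rw [show c * gauss α x - 1 - (c * gauss α z - 1) = c * (gauss α x - gauss α z) by ring,
      abs_mul, abs_of_nonneg hc]
    gcongr
    exact abs_gauss_sub_le hα x z
  calc _ = ‖(-(4 * α * c)) • (s • (V - V') + (s - s') • V')‖ := by
        congr 1
        module
    _ = 4 * α * c * ‖s • (V - V') + (s - s') • V'‖ := by
        rw [norm_smul, norm_neg, Real.norm_of_nonneg (by positivity)]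
    _ ≤ 4 * α * c * (|s| * ‖V - V'‖ + |s - s'| * ‖V'‖) := by
        gcongr
        refine (norm_add_le _ _).trans ?_
        rw [norm_smul, norm_smul, Real.norm_eq_abs, Real.norm_eq_abs]
    _ ≤ 4 * α * c * (c * (3 * ‖x - z‖) + c * (2 * α * ‖x - z‖) * 1) := by
        gcongr
        · exact norm_gauss_smul_sub_le hα x z
        · exact norm_gauss_smul_le hα z
    _ = _ := by ring

theorem abs_second_difference_le {g : E n → ℝ} {Dg : E n → E n} {L : ℝ}
    (hg : ∀ x, HasGradientAt g (Dg x) x) (hL : ∀ x z, ‖Dg x - Dg z‖ ≤ L * ‖x - z‖) (x y : E n) :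
    |g (x + y) + g (x - y) - 2 * g x| ≤ 2 * L * ‖y‖ ^ 2 := by
  have hd : ∀ s : ℝ, HasDerivAt (fun s : ℝ => g (x + s • y) + g (x - s • y))
      (⟪Dg (x + s • y) - Dg (x - s • y), y⟫) s := by
    intro s
    have h0 : HasDerivAt (fun s : ℝ => s • y) y s := by
      simpa using (hasDerivAt_id s).smul_const y
    have h1 := (hasGradientAt_iff_hasFDerivAt.1 (hg (x + s • y))).comp_hasDerivAt s (h0.const_add x)
    have h2 := (hasGradientAt_iff_hasFDerivAt.1 (hg (x - s • y))).comp_hasDerivAt s (h0.const_sub x)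
    refine (h1.add h2).congr_deriv ?_
    rw [inner_sub_left]
    simp [sub_eq_add_neg]
  have hL0 : 0 ≤ L * ‖y‖ := (norm_nonneg _).trans (by simpa using hL y 0)
  have h := norm_image_sub_le_of_norm_deriv_le_segment' (a := (0 : ℝ)) (b := 1)
    (C := 2 * L * ‖y‖ ^ 2) (fun s _ => (hd s).hasDerivWithinAt) (fun s hs => ?_) 1
    (right_mem_Icc.2 zero_le_one)
  · simp only [one_smul, zero_smul, add_zero, sub_zero, mul_one, Real.norm_eq_abs] at h
    rw [two_mul (g x)]
    exact h
  · rw [Real.norm_eq_abs]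
    refine (abs_real_inner_le_norm _ _).trans ?_
    have h1 := hL (x + s • y) (x - s • y)
    rw [show x + s • y - (x - s • y) = (2 * s) • y by module, norm_smul,
      Real.norm_of_nonneg (by linarith [hs.1])] at h1
    nlinarith [mul_le_mul_of_nonneg_right h1 (norm_nonneg y), hs.1, hs.2,
      mul_nonneg hL0 (norm_nonneg y)]

/-- A bound on `M⁻` of the truncated Gaussians of amplitude at most `c`. -/
def pucciBound (n : ℕ) (Λ σ₀ α c : ℝ) : ℝ :=
  Λ * (n * volume.real (Metric.ball (0 : E n) 1)) *
    (2 * (4 * α * c ^ 2 * (3 + 2 * α)) + 2 * c ^ 2 * (2 / σ₀))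

theorem pucci_truncGauss (hn : 1 ≤ n) {Λ σ₀ σ α c C N : ℝ} (hΛ : 1 ≤ Λ) (hσ₀ : 0 < σ₀)
    (hσ : σ₀ < σ) (hσ2 : σ < 2) (hα : 1 ≤ α) (hc : 0 ≤ c) (hcC : c ≤ C) (hN : 0 ≤ N)
    (hbig : 3 * n * α / 2 ≤ volume.real (Metric.ball (0 : E n) 1) * (4 * α) ^ (σ₀ / 2) *
      (3 * α / (128 * Λ) - Λ * n / 4 - Λ * n * (2 / σ₀))) (x : E n) {d : E n → ℝ}
    (hd : ∀ y, d y =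
      N * (truncGauss α c (x + y) + truncGauss α c (x - y) - 2 * truncGauss α c x)) :
    (Integrable fun y : E n => pucci Λ (d y) / ‖y‖ ^ ((n : ℝ) + σ)) ∧
    -(N * pucciBound n Λ σ₀ α C) ≤
      (2 - σ) * ∫ y : E n, pucci Λ (d y) / ‖y‖ ^ ((n : ℝ) + σ) ∧
    (1 / 4 ≤ ‖x‖ → N * truncSlope α c x * (3 * n * α / 2) ≤
      (2 - σ) * ∫ y : E n, pucci Λ (d y) / ‖y‖ ^ ((n : ℝ) + σ)) := by
  have hα0 : 0 ≤ α := by linarith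
  have hcont : Continuous d := by
    have := continuous_truncGauss (n := n) α c
    rw [funext hd]
    fun_prop
  have hL : ∀ y, |d y| ≤ N * (2 * (4 * α * C ^ 2 * (3 + 2 * α))) * ‖y‖ ^ 2 := by
    intro y
    rw [hd, abs_mul, abs_of_nonneg hN, mul_assoc]
    refine mul_le_mul_of_nonneg_left ((abs_second_difference_le
      (hasGradientAt_truncGauss α c) (norm_gradient_truncGauss_sub_le hα hc) x y).trans ?_) hN
    gcongr
  have hM : ∀ y, |d y| ≤ N * (2 * C ^ 2) := by
    intro y
    rw [hd, abs_mul, abs_of_nonneg hN]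
    refine mul_le_mul_of_nonneg_left ?_ hN
    have hC : c ^ 2 ≤ C ^ 2 := by gcongr
    rw [abs_le]
    constructor <;> linarith [truncGauss_nonneg α c (x + y), truncGauss_nonneg α c (x - y),
      truncGauss_nonneg α c x, truncGauss_le hα0 hc (x + y), truncGauss_le hα0 hc (x - y),
      truncGauss_le hα0 hc x]
  have hslope := truncSlope_nonneg (α := α) hc x
  have hfactor : ∀ y, N * truncSlope α c x *
      (Real.exp (-(α * ‖y‖ ^ 2)) * Real.cosh (2 * α * ⟪x, y⟫) - 1) ≤ d y := by
    intro y
    rw [hd, mul_assoc]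
    exact mul_le_mul_of_nonneg_left (truncGauss_second_difference_ge α c x y) hN
  refine ⟨integrable_pucci_kernel hn hΛ (hσ₀.trans hσ) hσ2 hcont hL hM, ?_, fun hx => ?_⟩
  · refine le_trans (le_of_eq ?_) (neg_le_integral_pucci_kernel hn hΛ hσ₀ hσ hσ2 hcont hL hM)
    unfold pucciBound
    ring
  · refine le_integral_pucci_kernel_of_quadratic hn hΛ hσ₀ hσ hσ2 hα (mul_nonneg hN hslope) hcont
      hL hM hx (fun y hy => ?_) (fun y => ?_) hbig
    · exact (mul_le_mul_of_nonneg_left (gauss_factor_ge_quadratic hy)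
        (mul_nonneg hN hslope)).trans (hfactor y)
    · refine le_trans ?_ (hfactor y)
      nlinarith [gauss_factor_ge α x y, mul_nonneg hN hslope]

/-- The amplitude of the barrier: it grows exponentially up to time `1`. -/
def barrierAmp (n : ℕ) (α t : ℝ) : ℝ := Real.exp (3 * n * α * min t 1)

/-- The decaying factor of the barrier, constant up to time `1`. -/
def barrierDecay (K t : ℝ) : ℝ := 200 * Real.exp (K * (79 - max (t - 1) 0))

/-- The barrier function. -/
def barrier (α K : ℝ) (x : E n) (t : ℝ) : ℝ :=
  barrierDecay K t * truncGauss α (barrierAmp n α t) x - t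

/-- The left time derivative of the barrier before time `1`. -/
def barrierDerivEarly (α K : ℝ) (x : E n) (t : ℝ) : ℝ :=
  200 * Real.exp (K * 79) * (2 * max (Real.exp (3 * n * α * t) * gauss α x - 1) 0 *
    (3 * n * α * Real.exp (3 * n * α * t) * gauss α x)) - 1

/-- The time derivative of the barrier after time `1`. -/
def barrierDerivLate (α K : ℝ) (x : E n) (t : ℝ) : ℝ :=
  -K * (200 * Real.exp (K * (79 - (t - 1)))) * truncGauss α (Real.exp (3 * n * α)) x - 1

/-- The left time derivative of the barrier. -/
def barrierDeriv (α K : ℝ) (x : E n) (t : ℝ) : ℝ :=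
  if t ≤ 1 then barrierDerivEarly α K x t else barrierDerivLate α K x t

theorem barrierDecay_pos (K t : ℝ) : 0 < barrierDecay K t := by
  unfold barrierDecay
  positivity

theorem barrierAmp_pos (α t : ℝ) : 0 < barrierAmp n α t := Real.exp_pos _

theorem barrierAmp_le {α : ℝ} (hα : 0 ≤ α) (t : ℝ) : barrierAmp n α t ≤ Real.exp (3 * n * α) :=
  Real.exp_le_exp.2 (mul_le_of_le_one_right (by positivity) (min_le_right _ _))

theorem barrierAmp_of_le (α : ℝ) {t : ℝ} (ht : t ≤ 1) :
    barrierAmp n α t = Real.exp (3 * n * α * t) := by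
  rw [barrierAmp, min_eq_left ht]

theorem barrierAmp_of_ge (α : ℝ) {t : ℝ} (ht : 1 ≤ t) :
    barrierAmp n α t = Real.exp (3 * n * α) := by
  rw [barrierAmp, min_eq_right ht, mul_one]

theorem barrierDecay_of_le (K : ℝ) {t : ℝ} (ht : t ≤ 1) :
    barrierDecay K t = 200 * Real.exp (K * 79) := by
  rw [barrierDecay, max_eq_right (by linarith), sub_zero]

theorem barrierDecay_of_ge (K : ℝ) {t : ℝ} (ht : 1 ≤ t) :
    barrierDecay K t = 200 * Real.exp (K * (79 - (t - 1))) := by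
  rw [barrierDecay, max_eq_left (by linarith)]

theorem continuous_barrier (α K : ℝ) : Continuous fun q : E n × ℝ => barrier α K q.1 q.2 := by
  unfold barrier barrierDecay truncGauss barrierAmp gauss
  fun_prop

theorem continuous_barrierDerivEarly (α K : ℝ) :
    Continuous fun q : E n × ℝ => barrierDerivEarly α K q.1 q.2 := by
  unfold barrierDerivEarly gauss
  fun_prop

theorem continuous_barrierDerivLate (α K : ℝ) :
    Continuous fun q : E n × ℝ => barrierDerivLate α K q.1 q.2 := by
  unfold barrierDerivLate truncGauss gauss
  fun_prop

theorem parContinuousOn_ite {F G : E n × ℝ → ℝ} (hF : Continuous F) (hG : Continuous G) (T : ℝ)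
    (S : Set (E n × ℝ)) : ParContinuousOn (fun q => if q.2 ≤ T then F q else G q) S := by
  intro p _ ε hε
  have hdist : ∀ (q : E n × ℝ) (δ : ℝ), dist q.1 p.1 < δ → q.2 ∈ Ioc (p.2 - δ) p.2 →
      dist q p < δ := by
    intro q δ h1 h2
    rw [Prod.dist_eq, max_lt_iff, Real.dist_eq, abs_lt]
    exact ⟨h1, by linarith [h2.1], by linarith [h2.2, dist_nonneg.trans_lt h1]⟩
  by_cases hp : p.2 ≤ T
  · obtain ⟨δ, hδ, h⟩ := Metric.continuous_iff.1 hF p ε hε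
    refine ⟨δ, hδ, fun q _ h1 h2 => ?_⟩
    simpa only [if_pos hp, if_pos (h2.2.trans hp), Real.dist_eq] using h q (hdist q δ h1 h2)
  · obtain ⟨δ, hδ, h⟩ := Metric.continuous_iff.1 hG p ε hε
    refine ⟨min δ (p.2 - T), lt_min hδ (by linarith), fun q _ h1 h2 => ?_⟩
    have hq : ¬ q.2 ≤ T := by
      have := min_le_right δ (p.2 - T)
      linarith [h2.1]
    simpa only [if_neg hp, if_neg hq, Real.dist_eq] using h q ((hdist q _ h1 h2).trans_le (min_le_left _ _))

theorem hasDerivWithinAt_barrier (α K : ℝ) (x : E n) (t : ℝ) :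
    HasDerivWithinAt (fun s => barrier α K x s) (barrierDeriv α K x t) (Iic t) t := by
  unfold barrierDeriv
  split_ifs with ht
  · have hexp : HasDerivAt (fun s : ℝ => Real.exp (3 * n * α * s))
        (Real.exp (3 * n * α * t) * (3 * n * α)) t := by
      simpa using ((hasDerivAt_id t).const_mul (3 * n * α)).exp
    have h := (((hasDerivAt_max_zero_sq _).comp t
      ((hexp.mul_const (gauss α x)).sub_const 1)).const_mul (200 * Real.exp (K * 79))).sub
        (hasDerivAt_id t)
    refine (h.hasDerivWithinAt.congr_deriv ?_).congr (fun s hs => ?_) ?_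
    · unfold barrierDerivEarly
      ring
    · simp only [barrier, barrierDecay_of_le K (hs.trans ht), barrierAmp_of_le α (hs.trans ht)]
      rfl
    · simp only [barrier, barrierDecay_of_le K ht, barrierAmp_of_le α ht]
      rfl
  · have ht' : 1 < t := not_le.1 ht
    have hexp : HasDerivAt (fun s : ℝ => Real.exp (K * (79 - (s - 1))))
        (Real.exp (K * (79 - (t - 1))) * (K * (-1))) t :=
      ((((hasDerivAt_id t).sub_const 1).const_sub 79).const_mul K).exp
    have h := ((hexp.const_mul 200).mul_const (truncGauss α (Real.exp (3 * n * α)) x)).sub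
      (hasDerivAt_id t)
    refine HasDerivAt.hasDerivWithinAt ((h.congr_deriv ?_).congr_of_eventuallyEq ?_)
    · unfold barrierDerivLate
      ring
    · filter_upwards [Ioi_mem_nhds ht'] with s hs
      simp only [barrier, barrierDecay_of_ge K (le_of_lt hs), barrierAmp_of_ge α (le_of_lt hs)]
      rfl

theorem hasGradientAt_barrier (α K : ℝ) (x : E n) (t : ℝ) :
    HasGradientAt (fun z => barrier α K z t)
      (barrierDecay K t • ((-(4 * α * barrierAmp n α t) *
        max (barrierAmp n α t * gauss α x - 1) 0) • (gauss α x • x))) x := by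
  rw [hasGradientAt_iff_hasFDerivAt]
  have h := ((hasGradientAt_iff_hasFDerivAt.1
    (hasGradientAt_truncGauss α (barrierAmp n α t) x)).const_mul (barrierDecay K t)).sub_const t
  refine h.congr_fderiv ?_
  exact ((InnerProductSpace.toDual ℝ (E n)).map_smulₛₗ (barrierDecay K t) _).symm

theorem barrierDecay_le {K : ℝ} (hK : 0 ≤ K) (t : ℝ) :
    barrierDecay K t ≤ 200 * Real.exp (K * 79) := by
  unfold barrierDecay
  gcongr
  linarith [le_max_right (t - 1) 0]

theorem sdelta_barrier (α K : ℝ) (x : E n) (t : ℝ) (y : E n) :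
    sdelta (barrier α K) x t y = barrierDecay K t * (truncGauss α (barrierAmp n α t) (x + y) +
      truncGauss α (barrierAmp n α t) (x - y) - 2 * truncGauss α (barrierAmp n α t) x) := by
  unfold sdelta barrier
  ring

theorem pucciBound_nonneg (n : ℕ) {Λ σ₀ α : ℝ} (hΛ : 0 ≤ Λ) (hσ₀ : 0 ≤ σ₀) (hα : 0 ≤ α) (c : ℝ) :
    0 ≤ pucciBound n Λ σ₀ α c := by
  unfold pucciBound
  positivity

theorem barrierDerivEarly_eq (α K : ℝ) (x : E n) {t : ℝ} (ht : t ≤ 1) :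
    barrierDerivEarly α K x t =
      barrierDecay K t * truncSlope α (barrierAmp n α t) x * (3 * n * α / 2) - 1 := by
  rw [barrierDecay_of_le K ht, barrierAmp_of_le α ht]
  unfold barrierDerivEarly truncSlope
  ring

theorem barrierDerivLate_eq (α K : ℝ) (x : E n) {t : ℝ} (ht : 1 ≤ t) :
    barrierDerivLate α K x t =
      -K * barrierDecay K t * truncGauss α (Real.exp (3 * n * α)) x - 1 := by
  rw [barrierDecay_of_ge K ht]
  rfl

theorem truncSlope_le {α c C : ℝ} (hα : 0 ≤ α) (hc : 0 ≤ c) (hcC : c ≤ C) (x : E n) :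
    truncSlope α c x ≤ 4 * C ^ 2 := by
  have h1 := trunc_le hα hc x
  have h2 := gauss_le_one hα x
  have h3 := gauss_pos α x
  have h4 : 0 ≤ max (c * gauss α x - 1) 0 := le_max_right _ _
  unfold truncSlope
  calc 2 * max (c * gauss α x - 1) 0 * c * (2 * gauss α x) ≤ 2 * c * c * (2 * 1) := by gcongr
    _ = 4 * c ^ 2 := by ring
    _ ≤ 4 * C ^ 2 := by gcongr

theorem le_exp_mul_gauss_sub_one (α : ℝ) {x : E n} {R : ℝ} (hα : 0 ≤ α) (hx : ‖x‖ ^ 2 ≤ R) :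
    α * (3 * n - R) ≤ Real.exp (3 * n * α) * gauss α x - 1 := by
  unfold gauss
  rw [← Real.exp_add]
  have := Real.add_one_le_exp (3 * n * α + -(α * ‖x‖ ^ 2))
  nlinarith [mul_le_mul_of_nonneg_left hx hα]

theorem trunc_eq_zero {α : ℝ} (hα : 0 ≤ α) {t : ℝ} {x : E n} (hx : 3 * n * t ≤ ‖x‖ ^ 2) :
    truncGauss α (Real.exp (3 * n * α * t)) x = 0 := by
  unfold truncGauss gauss
  rw [← Real.exp_add, max_eq_right, zero_pow two_ne_zero]
  rw [sub_nonpos, Real.exp_le_one_iff]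
  nlinarith [mul_le_mul_of_nonneg_left hx hα]

theorem barrier_nonpos {α : ℝ} (hα : 0 ≤ α) (K : ℝ) {t : ℝ} (ht : 0 ≤ t) {x : E n}
    (hx : 3 * n * min t 1 ≤ ‖x‖ ^ 2) : barrier α K x t ≤ 0 := by
  rw [barrier, barrierAmp, trunc_eq_zero hα hx]
  linarith

theorem barrier_gt_two (hn : 1 ≤ n) {α K t : ℝ} (hα : 1 ≤ α) (hK : 0 ≤ K) (ht : t ∈ Icc (1 : ℝ) 80)
    {x : E n} (hx : x ∈ cube (0 : E n) 3) : 2 < barrier α K x t := by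
  have hn' : (1 : ℝ) ≤ n := by exact_mod_cast hn
  have hx2 : ‖x‖ ^ 2 ≤ 9 / 4 * n := by
    rw [EuclideanSpace.norm_sq_eq]
    calc ∑ i, ‖x i‖ ^ 2 ≤ ∑ _i : Fin n, (9 / 4 : ℝ) := by
          refine Finset.sum_le_sum fun i _ => ?_
          have h : |x i| < 3 / 2 := by simpa using hx i
          rw [Real.norm_eq_abs]
          nlinarith [abs_nonneg (x i)]
      _ = 9 / 4 * n := by simp [mul_comm]
  have h1 : 3 / 4 ≤ Real.exp (3 * n * α) * gauss α x - 1 := by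
    have := le_exp_mul_gauss_sub_one α (by linarith : 0 ≤ α) hx2
    nlinarith
  have h2 : 9 / 16 ≤ truncGauss α (Real.exp (3 * n * α)) x := by
    have := h1.trans (le_max_left _ 0)
    unfold truncGauss
    nlinarith
  have h3 : 200 ≤ barrierDecay K t := by
    rw [barrierDecay_of_ge K ht.1]
    have : 1 ≤ Real.exp (K * (79 - (t - 1))) :=
      Real.one_le_exp (mul_nonneg hK (by linarith [ht.2]))
    linarith
  rw [barrier, barrierAmp_of_ge α ht.1]
  have := mul_le_mul h3 h2 (by norm_num) (by linarith)
  linarith [ht.2]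

theorem one_le_truncGauss (hn : 1 ≤ n) {α : ℝ} (hα : 1 ≤ α) {x : E n} (hx : ‖x‖ < 1 / 4) :
    1 ≤ truncGauss α (Real.exp (3 * n * α)) x := by
  have hn' : (1 : ℝ) ≤ n := by exact_mod_cast hn
  have hx2 : ‖x‖ ^ 2 ≤ 1 / 16 := by nlinarith [norm_nonneg x]
  have h := le_exp_mul_gauss_sub_one α (by linarith : 0 ≤ α) hx2
  have h1 : 1 ≤ max (Real.exp (3 * n * α) * gauss α x - 1) 0 :=
    le_trans (by nlinarith) (h.trans (le_max_left _ 0))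
  exact one_le_pow₀ h1

end NLP

open NLP in
/-- **Special function** (Lemma 4.2). -/
theorem special_function (n : ℕ) (hn : 1 ≤ n) (Λ σ₀ : ℝ) (hΛ : 1 ≤ Λ)
    (hσ₀ : σ₀ ∈ Ioo (0 : ℝ) 2) :
    ∃ (p : E n → ℝ → ℝ) (C : ℝ), 1 < C ∧
      -- p is continuous on ℝⁿ × [0,80]
      ContinuousOn (fun q : E n × ℝ => p q.1 q.2) (univ ×ˢ Icc (0 : ℝ) 80) ∧
      -- p(·,t) is C^{1,1} in the space variable
      (∃ (Dp : E n → ℝ → E n) (L : NNReal),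
        (∀ t ∈ Icc (0 : ℝ) 80, ∀ x : E n, HasGradientAt (fun z => p z t) (Dp x t) x) ∧
        ∀ t ∈ Icc (0 : ℝ) 80, LipschitzWith L fun x => Dp x t) ∧
      -- p is C¹ in time w.r.t. the parabolic topology, with left derivative p_t
      ∃ pt : E n → ℝ → ℝ,
        (∀ x : E n, ∀ t ∈ Ioc (0 : ℝ) 80,
          HasDerivWithinAt (fun s => p x s) (pt x t) (Iic t) t) ∧
        ParContinuousOn (fun q : E n × ℝ => pt q.1 q.2) (univ ×ˢ Ioc (0 : ℝ) 80) ∧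
        -- (1) the equation, classically evaluated, uniformly in σ ∈ (σ₀,2)
        (∀ σ : ℝ, σ ∈ Ioo σ₀ 2 →
          ∀ x ∈ Metric.ball (0 : E n) (4 * Real.sqrt n), ∀ t ∈ Ioc (0 : ℝ) 80,
            (Integrable fun y : E n =>
              (Λ⁻¹ * sdeltaP p x t y - Λ * sdeltaN p x t y) / ‖y‖ ^ ((n : ℝ) + σ)) ∧
            pt x t - Mminus Λ σ p x t ≤
              -1 + (Metric.ball (0 : E n) (1 / 4) ×ˢ Ioc (0 : ℝ) 1).indicator
                (fun _ => C) (x, t)) ∧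
        -- (2) p ≤ 0 outside B_{2√n} × (0,80] and at time 0
        (∀ x : E n, ∀ t ∈ Ioc (0 : ℝ) 80,
          x ∉ Metric.ball (0 : E n) (2 * Real.sqrt n) → p x t ≤ 0) ∧
        (∀ x : E n, p x 0 ≤ 0) ∧
        -- (3) p > 2 on Q₃ × [1,80]
        (∀ x ∈ cube (0 : E n) 3, ∀ t ∈ Icc (1 : ℝ) 80, 2 < p x t) := by
  have hn' : (1 : ℝ) ≤ n := by exact_mod_cast hn
  obtain ⟨α, hα, hbig⟩ := exists_gaussian_exponent hn hΛ hσ₀.1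
  have hα0 : 0 ≤ α := by linarith
  set A := Real.exp (3 * n * α) with hA
  set K := pucciBound n Λ σ₀ α A with hK_def
  have hK : 0 ≤ K := pucciBound_nonneg n (by linarith) hσ₀.1.le hα0 A
  set N := 200 * Real.exp (K * 79) with hN_def
  have hN : 0 < N := by positivity
  have hamp : ∀ t, barrierAmp n α t ≤ A := barrierAmp_le hα0
  refine ⟨barrier α K, N * (4 * A ^ 2) * (3 * n * α / 2) + N * K + 2, ?_,
    (continuous_barrier α K).continuousOn, ⟨fun x t => barrierDecay K t •
      ((-(4 * α * barrierAmp n α t) * max (barrierAmp n α t * gauss α x - 1) 0) •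
        (gauss α x • x)), Real.toNNReal (N * (4 * α * A ^ 2 * (3 + 2 * α))),
      fun t _ x => hasGradientAt_barrier α K x t, fun t _ => ?_⟩, barrierDeriv α K,
    fun x t _ => hasDerivWithinAt_barrier α K x t,
    parContinuousOn_ite (continuous_barrierDerivEarly α K) (continuous_barrierDerivLate α K) 1 _,
    ?_, fun x t ht hx => ?_, fun x => ?_, fun x hx t ht => barrier_gt_two hn hα hK ht hx⟩
  · have : 0 ≤ N * (4 * A ^ 2) * (3 * n * α / 2) + N * K := by positivity
    linarith
  · refine LipschitzWith.of_dist_le_mul fun x z => ?_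
    rw [Real.coe_toNNReal _ (by positivity), dist_eq_norm, dist_eq_norm, ← smul_sub, norm_smul,
      Real.norm_of_nonneg (barrierDecay_pos K t).le, mul_assoc N]
    refine mul_le_mul (barrierDecay_le hK t) ((norm_gradient_truncGauss_sub_le hα
      (barrierAmp_pos α t).le x z).trans ?_) (norm_nonneg _) hN.le
    have := (barrierAmp_pos (n := n) α t).le
    have := hamp t
    gcongr
  · intro σ hσ x _ t ht
    obtain ⟨hint, hin, hout⟩ := pucci_truncGauss hn hΛ hσ₀.1 hσ.1 hσ.2 hα (barrierAmp_pos α t).le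
      (hamp t) (barrierDecay_pos K t).le hbig x (sdelta_barrier α K x t)
    refine ⟨hint, ?_⟩
    have hin' : -(barrierDecay K t * K) ≤ Mminus Λ σ (barrier α K) x t := hin
    have hout' : 1 / 4 ≤ ‖x‖ → barrierDecay K t * truncSlope α (barrierAmp n α t) x *
      (3 * n * α / 2) ≤ Mminus Λ σ (barrier α K) x t := hout
    have hslope := truncSlope_nonneg (α := α) (barrierAmp_pos (n := n) α t).le x
    have hdec := barrierDecay_pos K t
    have hind : 0 ≤ (Metric.ball (0 : E n) (1 / 4) ×ˢ Ioc (0 : ℝ) 1).indicator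
        (fun _ => N * (4 * A ^ 2) * (3 * n * α / 2) + N * K + 2) (x, t) :=
      indicator_nonneg (fun _ _ => by positivity) _
    unfold barrierDeriv
    split_ifs with ht1
    · rw [barrierDerivEarly_eq α K x ht1]
      rcases le_or_gt (1 / 4) ‖x‖ with hx | hx
      · linarith [hout' hx]
      · have hmem : (x, t) ∈ Metric.ball (0 : E n) (1 / 4) ×ˢ Ioc (0 : ℝ) 1 :=
          ⟨by simpa using hx, ht.1, ht1⟩
        rw [indicator_of_mem hmem]
        have hdN : barrierDecay K t = N := barrierDecay_of_le K ht1
        rw [hdN] at hin' ⊢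
        have : N * truncSlope α (barrierAmp n α t) x * (3 * n * α / 2) ≤
            N * (4 * A ^ 2) * (3 * n * α / 2) := by
          gcongr
          exact truncSlope_le hα0 (barrierAmp_pos α t).le (hamp t) x
        linarith
    · rw [barrierDerivLate_eq α K x (not_le.1 ht1).le]
      rcases le_or_gt (1 / 4) ‖x‖ with hx | hx
      · have h1 : 0 ≤ barrierDecay K t * truncSlope α (barrierAmp n α t) x * (3 * n * α / 2) := by
          positivity
        have h2 : 0 ≤ K * barrierDecay K t * truncGauss α A x :=
          mul_nonneg (by positivity) (truncGauss_nonneg _ _ _)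
        linarith [hout' hx]
      · have h1 := mul_le_mul_of_nonneg_left (one_le_truncGauss hn hα hx)
          (mul_nonneg hK hdec.le)
        linarith
  · refine barrier_nonpos hα0 K ht.1.le ?_
    have h1 : 2 * Real.sqrt n ≤ ‖x‖ := by simpa using hx
    have h2 : (2 * Real.sqrt n) ^ 2 ≤ ‖x‖ ^ 2 := by gcongr
    rw [mul_pow, Real.sq_sqrt (by positivity)] at h2
    have h3 : 3 * (n : ℝ) * min t 1 ≤ 3 * n * 1 := by
      gcongr
      exact min_le_right _ _
    linarith
  · refine barrier_nonpos hα0 K le_rfl ?_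
    rw [min_eq_left zero_le_one, mul_zero]
    positivity
end
end
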